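/- Let G be a group with a finite symmetric generating set S, let 1 ≤ p < ∞, let f : G → ℝ be p-Dirichlet, and let ξ : G → ℝ be finitely supported with Σ_{γ∈G} ξ(γ) = 1. Then the function ξ * f − f belongs to ℓ^p(G). -/

import Mathlib

open Filter Topology

/-- Word length of `g` with respect to the generating set `S`. -/
noncomputable def wordLength {G : Type*} [Group G] (S : Finset G) (g : G) : ℕ :=
  sInf {n : ℕ | ∃ l : List G, l.length = n ∧ (∀ x ∈ l, x ∈ S) ∧ l.prod = g}

/-- Cayley graph distance `d(x,y) = |y * x⁻¹|`. -/
noncomputable def cayleyDist {G : Type*} [Group G] (S : Finset G) (x y : G) : ℝ :=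
  (wordLength S (y * x⁻¹) : ℝ)

/-- Partial gradient `∇ₛ f (x) = f (s⁻¹ x) - f x`. -/
def grad {G : Type*} [Group G] (s : G) (f : G → ℝ) : G → ℝ :=
  fun x => f (s⁻¹ * x) - f x

/-- `f` is `p`-summable. -/
def MemLp' {G : Type*} (p : ℝ) (f : G → ℝ) : Prop :=
  Summable fun x => |f x| ^ p

/-- The `ℓ^p` norm of `f`. -/
noncomputable def lpNorm {G : Type*} (p : ℝ) (f : G → ℝ) : ℝ :=
  (∑' x, |f x| ^ p) ^ (1 / p)

/-- `f` is `p`-Dirichlet: every partial gradient is in `ℓ^p`. -/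
def IsDirichlet {G : Type*} [Group G] (S : Finset G) (p : ℝ) (f : G → ℝ) : Prop :=
  ∀ s ∈ S, MemLp' p (grad s f)

/-- Convolution `(ξ * f)(x) = ∑ ξ γ • f (γ⁻¹ x)`. -/
noncomputable def conv {G : Type*} [Group G] (ξ f : G → ℝ) : G → ℝ :=
  fun x => ∑' γ, ξ γ * f (γ⁻¹ * x)

/-- A finitely supported probability measure on `G`. -/
def IsProbMeasure {G : Type*} (ξ : G → ℝ) : Prop :=
  (∀ x, 0 ≤ ξ x) ∧ (Function.support ξ).Finite ∧ (∑' x, ξ x) = 1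

/-- `ξ^∨ (x) = ξ (x⁻¹)`. -/
def invMeasure {G : Type*} [Group G] (ξ : G → ℝ) : G → ℝ := fun x => ξ x⁻¹

/-- `(ρ_s ξ^∨)(x) = ξ^∨ (x * s)`. -/
def rhoInvMeasure {G : Type*} [Group G] (ξ : G → ℝ) (s : G) : G → ℝ :=
  fun x => ξ (x * s)⁻¹

/-- `m` is a coupling of `ξ` and `φ`. -/
def IsCoupling {G : Type*} (m : G × G → ℝ) (ξ φ : G → ℝ) : Prop :=
  (∀ z, 0 ≤ m z) ∧ (Function.support m).Finite ∧
    (∀ x, (∑' y, m (x, y)) = ξ x) ∧ (∀ y, (∑' x, m (x, y)) = φ y)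

/-- The transportation cost between `ξ` and `φ`, for the Cayley distance of `(G,S)`. -/
noncomputable def Trc {G : Type*} [Group G] (S : Finset G) (ξ φ : G → ℝ) : ℝ :=
  sInf {c : ℝ | ∃ m, IsCoupling m ξ φ ∧ c = ∑' z : G × G, m z * cayleyDist S z.1 z.2}

/-- `G` is transport amenable (with respect to `S`). -/
def TransportAmenable {G : Type*} [Group G] (S : Finset G) : Prop :=
  ∃ K > (0 : ℝ), ∃ ξ : ℕ → G → ℝ,
    (∀ n, IsProbMeasure (ξ n)) ∧
    (∀ γ : G, Tendsto (fun n => ∑' x, |ξ n (γ⁻¹ * x) - ξ n x|) atTop (𝓝 0)) ∧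
    (∀ s ∈ S, ∀ n, Trc S (rhoInvMeasure (ξ n) s) (invMeasure (ξ n)) ≤ K)

theorem memLp'_iff_memℓp {G : Type*} {p : ℝ} (hp : 1 ≤ p) (f : G → ℝ) :
    MemLp' p f ↔ Memℓp f (ENNReal.ofReal p) := by
  have hp0 : 0 < p := one_pos.trans_le hp
  have h : (ENNReal.ofReal p).toReal = p := ENNReal.toReal_ofReal hp0.le
  rw [memℓp_gen_iff (by rwa [h]), h]
  rfl

theorem MemLp'.comp_mul_left {G : Type*} [Group G] {p : ℝ} {f : G → ℝ} (hf : MemLp' p f)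
    (g : G) : MemLp' p (fun x => f (g * x)) :=
  (Equiv.mulLeft g).summable_iff.mpr hf

theorem MemLp'.neg {G : Type*} {p : ℝ} {f : G → ℝ} (hf : MemLp' p f) :
    MemLp' p (fun x => -f x) := by
  simpa only [MemLp', abs_neg] using hf

theorem MemLp'.add {G : Type*} {p : ℝ} (hp : 1 ≤ p) {f g : G → ℝ} (hf : MemLp' p f)
    (hg : MemLp' p g) : MemLp' p (fun x => f x + g x) :=
  (memLp'_iff_memℓp hp _).2
    (((memLp'_iff_memℓp hp f).1 hf).add ((memLp'_iff_memℓp hp g).1 hg))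

/-- The gradient of a `p`-Dirichlet function along any element of the group generated by `S`
is `p`-summable. -/
theorem IsDirichlet.memLp'_grad {G : Type*} [Group G] {S : Finset G} {p : ℝ} (hp : 1 ≤ p)
    {f : G → ℝ} (hf : IsDirichlet S p f) {g : G} (hg : g ∈ Subgroup.closure (S : Set G)) :
    MemLp' p (grad g f) := by
  induction hg using Subgroup.closure_induction with
  | mem s hs => exact hf s hs
  | one => simp [MemLp', grad, Real.zero_rpow (one_pos.trans_le hp).ne', summable_zero]
  | mul a b _ _ ha hb =>
    have h := (hb.comp_mul_left a⁻¹).add hp ha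
    convert h using 2 with x
    simp [grad, mul_assoc]
  | inv a _ ha =>
    have h := (ha.comp_mul_left a).neg
    convert h using 2 with x
    simp [grad]

/-- If `ξ` has finite support and total mass `1`, then `ξ * f - f` is a linear combination of
gradients of `f`. -/
theorem conv_sub_self_eq_sum_grad {G : Type*} [Group G] {ξ : G → ℝ}
    (hξfin : (Function.support ξ).Finite) (hξsum : (∑' γ, ξ γ) = 1) (f : G → ℝ) (x : G) :
    conv ξ f x - f x = ∑ γ ∈ hξfin.toFinset, ξ γ * grad γ f x := by
  have hzero : ∀ γ ∉ hξfin.toFinset, ξ γ = 0 := fun γ hγ => by simpa using hγ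
  rw [tsum_eq_sum hzero] at hξsum
  rw [conv, tsum_eq_sum fun γ hγ => by rw [hzero γ hγ, zero_mul]]
  simp only [grad, mul_sub, Finset.sum_sub_distrib, ← Finset.sum_mul, hξsum, one_mul]

theorem conv_sub_self_memLp_of_dirichlet
    {G : Type*} [Group G] (S : Finset G)
    (hsym : ∀ s ∈ S, s⁻¹ ∈ S) (hgen : Subgroup.closure (S : Set G) = ⊤)
    (p : ℝ) (hp : 1 ≤ p) (f : G → ℝ) (hf : IsDirichlet S p f)
    (ξ : G → ℝ) (hξfin : (Function.support ξ).Finite) (hξsum : (∑' γ, ξ γ) = 1) :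
    MemLp' p (fun x => conv ξ f x - f x) := by
  simp only [conv_sub_self_eq_sum_grad hξfin hξsum]
  rw [memLp'_iff_memℓp hp]
  refine Memℓp.finsetSum (f := fun γ x => ξ γ * grad γ f x) _ fun γ _ => ?_
  have hγ : MemLp' p (grad γ f) := hf.memLp'_grad hp (hgen ▸ Subgroup.mem_top γ)
  exact ((memLp'_iff_memℓp hp _).1 hγ).const_mul (ξ γ)
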